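/- In the setting of a quasi-bimonad (A, F, Φ) in K, for left Tambara modules X, Y, Z the associativity constraint α_{X,Y,Z} = (ν_X × ν_Y × ν_Z)∘(rearrangement by τ's)∘(Φ × id_{XYZ}) satisfies the pentagon identity (Id_X × α_{Y,Z,W}) ∘ α_{X,YZ,W} ∘ (α_{X,Y,Z} × Id_W) = α_{X,Y,ZW} ∘ α_{XY,Z,W}, as a consequence of the 3-cocycle condition on Φ. -/

import Mathlib

open CategoryTheory Bicategory

namespace Paper

variable {K : Type*} [Bicategory K]

/-- A monad in a bicategory. -/
structure Mnd (a : K) where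
  E : a ⟶ a
  mul : E ≫ E ⟶ E
  unit : 𝟙 a ⟶ E
  assoc : (α_ E E E).inv ≫ mul ▷ E ≫ mul = E ◁ mul ≫ mul
  left_unit : (λ_ E).inv ≫ unit ▷ E ≫ mul = 𝟙 E
  right_unit : (ρ_ E).inv ≫ E ◁ unit ≫ mul = 𝟙 E

variable {a : K}

/-- Tensor (= horizontal composite) of two "unit elements". -/
def tunit {X Y : a ⟶ a} (u : 𝟙 a ⟶ X) (v : 𝟙 a ⟶ Y) : 𝟙 a ⟶ X ≫ Y :=
  (λ_ (𝟙 a)).inv ≫ u ▷ 𝟙 a ≫ X ◁ v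

/-- Multiplication on a composite `X ≫ Y` built from multiplications on `X`, `Y`
and a distributive law `d : Y ≫ X ⟶ X ≫ Y`. -/
def tmul {X Y : a ⟶ a} (mX : X ≫ X ⟶ X) (mY : Y ≫ Y ⟶ Y) (d : Y ≫ X ⟶ X ≫ Y) :
    (X ≫ Y) ≫ X ≫ Y ⟶ X ≫ Y :=
  (α_ X Y (X ≫ Y)).hom ≫ X ◁ ((α_ Y X Y).inv ≫ d ▷ Y ≫ (α_ X Y Y).hom) ≫
    (α_ X X (Y ≫ Y)).inv ≫ mX ▷ (Y ≫ Y) ≫ X ◁ mY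

/-- Comultiplication on a composite `X ≫ Y`. -/
def tcomul {X Y : a ⟶ a} (cX : X ⟶ X ≫ X) (cY : Y ⟶ Y ≫ Y) (d : X ≫ Y ⟶ Y ≫ X) :
    X ≫ Y ⟶ (X ≫ Y) ≫ X ≫ Y :=
  cX ▷ Y ≫ (α_ X X Y).hom ≫
    X ◁ (X ◁ cY ≫ (α_ X Y Y).inv ≫ d ▷ Y ≫ (α_ Y X Y).hom) ≫ (α_ X Y (X ≫ Y)).inv

/-- Extend distributive laws, moving `X` to the left across a composite `Y1 ≫ Y2`. -/
def dext {X Y1 Y2 : a ⟶ a} (d1 : Y1 ≫ X ⟶ X ≫ Y1) (d2 : Y2 ≫ X ⟶ X ≫ Y2) :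
    (Y1 ≫ Y2) ≫ X ⟶ X ≫ Y1 ≫ Y2 :=
  (α_ Y1 Y2 X).hom ≫ Y1 ◁ d2 ≫ (α_ Y1 X Y2).inv ≫ d1 ▷ Y2 ≫ (α_ X Y1 Y2).hom

/-- Extend distributive laws, moving `X` to the right across a composite `Y1 ≫ Y2`. -/
def dext' {X Y1 Y2 : a ⟶ a} (d1 : X ≫ Y1 ⟶ Y1 ≫ X) (d2 : X ≫ Y2 ⟶ Y2 ≫ X) :
    X ≫ Y1 ≫ Y2 ⟶ (Y1 ≫ Y2) ≫ X :=
  (α_ X Y1 Y2).inv ≫ d1 ▷ Y2 ≫ (α_ Y1 X Y2).hom ≫ Y1 ◁ d2 ≫ (α_ Y1 Y2 X).inv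

/-- Convolution product of `f g : 𝟙 a ⟶ T` with respect to a multiplication on `T`. -/
def conv {T : a ⟶ a} (m : T ≫ T ⟶ T) (f g : 𝟙 a ⟶ T) : 𝟙 a ⟶ T :=
  (λ_ (𝟙 a)).inv ≫ f ▷ 𝟙 a ≫ T ◁ g ≫ m

/-- Convolution product of `f g : T ⟶ 𝟙 a` with respect to a comultiplication on `T`. -/
def convC {T : a ⟶ a} (c : T ⟶ T ≫ T) (f g : T ⟶ 𝟙 a) : T ⟶ 𝟙 a :=
  c ≫ f ▷ T ≫ (λ_ T).hom ≫ g

/-- The multiplication on `E ≫ E ≫ E` built from `mul` and the distributive law `τ`. -/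
def mul3 {E : a ⟶ a} (mul : E ≫ E ⟶ E) (τ : E ≫ E ⟶ E ≫ E) :
    (E ≫ E ≫ E) ≫ E ≫ E ≫ E ⟶ E ≫ E ≫ E :=
  tmul mul (tmul mul mul τ) (dext τ τ)

/-- The multiplication on `E ≫ E ≫ E ≫ E`. -/
def mul4 {E : a ⟶ a} (mul : E ≫ E ⟶ E) (τ : E ≫ E ⟶ E ≫ E) :
    (E ≫ E ≫ E ≫ E) ≫ E ≫ E ≫ E ≫ E ⟶ E ≫ E ≫ E ≫ E :=
  tmul mul (mul3 mul τ) (dext τ (dext τ τ))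

/-- The comultiplication on `E ≫ E ≫ E`. -/
def comul3 {E : a ⟶ a} (comul : E ⟶ E ≫ E) (τ : E ≫ E ⟶ E ≫ E) :
    E ≫ E ≫ E ⟶ (E ≫ E ≫ E) ≫ E ≫ E ≫ E :=
  tcomul comul (tcomul comul comul τ) (dext' τ τ)

/-- The comultiplication on `E ≫ E ≫ E ≫ E`. -/
def comul4 {E : a ⟶ a} (comul : E ⟶ E ≫ E) (τ : E ≫ E ⟶ E ≫ E) :
    E ≫ E ≫ E ≫ E ⟶ (E ≫ E ≫ E ≫ E) ≫ E ≫ E ≫ E ≫ E :=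
  tcomul comul (comul3 comul τ) (dext' τ (dext' τ τ))

/-- "Action of `Q ≫ P` on `X ≫ Y`": `P` crosses `X` via `dPX`, then `Q` acts on `X`
and `P` acts on `Y`. -/
def actT {b : K} {P Q X : a ⟶ a} {Y : a ⟶ b}
    (dPX : P ≫ X ⟶ X ≫ P) (aQX : Q ≫ X ⟶ X) (aPY : P ≫ Y ⟶ Y) :
    (Q ≫ P) ≫ X ≫ Y ⟶ X ≫ Y :=
  (α_ Q P (X ≫ Y)).hom ≫ Q ◁ ((α_ P X Y).inv ≫ dPX ▷ Y ≫ (α_ X P Y).hom) ≫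
    (α_ Q X (P ≫ Y)).inv ≫ aQX ▷ (P ≫ Y) ≫ X ◁ aPY

/-- A quasi-bimonad `(A, F, μ, η, Δ, ε, τ_{F,F}, Φ)` in a 2-category, together with
the condition that `τ_{F,Id_A}` is natural with respect to `Φ`. -/
structure QuasiBimonad (a : K) extends Mnd a where
  comul : E ⟶ E ≫ E
  counit : E ⟶ 𝟙 a
  τ : E ≫ E ⟶ E ≫ E
  /-- `τ` is a left monadic distributive law -/
  τ_lm : E ◁ τ ≫ (α_ E E E).inv ≫ τ ▷ E ≫ (α_ E E E).hom ≫ E ◁ mul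
      = (α_ E E E).inv ≫ mul ▷ E ≫ τ
  τ_lm_unit : (λ_ E).inv ≫ unit ▷ E ≫ τ = (ρ_ E).inv ≫ E ◁ unit
  /-- `τ` is a right monadic distributive law -/
  τ_rm : τ ▷ E ≫ (α_ E E E).hom ≫ E ◁ τ ≫ (α_ E E E).inv ≫ mul ▷ E
      = (α_ E E E).hom ≫ E ◁ mul ≫ τ
  τ_rm_unit : (ρ_ E).inv ≫ E ◁ unit ≫ τ = (λ_ E).inv ≫ unit ▷ E
  /-- `τ` is a left comonadic distributive law -/
  τ_lc : comul ▷ E ≫ (α_ E E E).hom ≫ E ◁ τ ≫ (α_ E E E).inv ≫ τ ▷ E ≫ (α_ E E E).hom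
      = τ ≫ E ◁ comul
  τ_lc_counit : τ ≫ counit ▷ E ≫ (λ_ E).hom = E ◁ counit ≫ (ρ_ E).hom
  /-- `τ` is a right comonadic distributive law -/
  τ_rc : E ◁ comul ≫ (α_ E E E).inv ≫ τ ▷ E ≫ (α_ E E E).hom ≫ E ◁ τ
      = τ ≫ comul ▷ E ≫ (α_ E E E).hom
  τ_rc_counit : τ ≫ E ◁ counit ≫ (ρ_ E).hom = counit ▷ E ≫ (λ_ E).hom
  /-- counitality of the comultiplication -/
  counit_comul : comul ≫ counit ▷ E ≫ (λ_ E).hom = 𝟙 E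
  comul_counit : comul ≫ E ◁ counit ≫ (ρ_ E).hom = 𝟙 E
  /-- bialgebra-type compatibility of `mul` and `comul` through `τ` -/
  mul_comul : mul ≫ comul = comul ▷ E ≫ (E ≫ E) ◁ comul ≫ tmul mul mul τ
  comul_unit : unit ≫ comul = tunit unit unit
  counit_mul : mul ≫ counit = E ◁ counit ≫ (ρ_ E).hom ≫ counit
  counit_unit : unit ≫ counit = 𝟙 (𝟙 a)
  /-- the reassociator `Φ` -/
  Φ : 𝟙 a ⟶ E ≫ E ≫ E
  /-- `Φ` is normalized -/
  Φ_normal : Φ ≫ E ◁ (counit ▷ E) ≫ E ◁ (λ_ E).hom = tunit unit unit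
  /-- `Φ` is convolution invertible -/
  Φ_inv : ∃ Φ' : 𝟙 a ⟶ E ≫ E ≫ E,
      conv (mul3 mul τ) Φ Φ' = tunit unit (tunit unit unit) ∧
      conv (mul3 mul τ) Φ' Φ = tunit unit (tunit unit unit)
  /-- quasi-coassociativity -/
  quasi_coassoc :
      comul ≫ comul ▷ E ≫ (α_ E E E).hom ≫ (λ_ (E ≫ E ≫ E)).inv ≫
        Φ ▷ (E ≫ E ≫ E) ≫ mul3 mul τ
      = comul ≫ E ◁ comul ≫ (ρ_ (E ≫ E ≫ E)).inv ≫ (E ≫ E ≫ E) ◁ Φ ≫ mul3 mul τ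
  /-- the 3-cocycle condition for `Φ` -/
  cocycle :
      conv (mul4 mul τ)
        (conv (mul4 mul τ) (tunit unit Φ)
          (Φ ≫ E ◁ (comul ▷ E) ≫ E ◁ (α_ E E E).hom))
        (tunit Φ unit ≫ (α_ E (E ≫ E) E).hom ≫ E ◁ (α_ E E E).hom)
      = conv (mul4 mul τ) (Φ ≫ E ◁ (E ◁ comul))
          (Φ ≫ comul ▷ (E ≫ E) ≫ (α_ E E (E ≫ E)).hom)
  /-- `τ_{F,Id_A}` is natural with respect to `Φ` -/
  Φ_nat : (λ_ E).inv ≫ Φ ▷ E = (ρ_ E).inv ≫ E ◁ Φ ≫ dext' τ (dext' τ τ)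

/-- The data of a left Tambara module over a quasi-bimonad. -/
structure QBModData (Q : QuasiBimonad a) where
  X : a ⟶ a
  d : Q.E ≫ X ⟶ X ≫ Q.E
  act : Q.E ≫ X ⟶ X

/-- The axioms of a left Tambara module over a quasi-bimonad `(A, F, Φ)`:
`(X, τ_{F,X})` is an object of `QB(K)(F)` (monadic and comonadic distributive law,
naturality with respect to `Φ`, Yang–Baxter equation with `τ_{F,F}`), `X` is a left
`F`-module, and the action is a morphism in `QB(K)(F)`. -/
def IsQBMod (Q : QuasiBimonad a) (M : QBModData Q) : Prop :=
  (Q.E ◁ M.d ≫ (α_ Q.E M.X Q.E).inv ≫ M.d ▷ Q.E ≫ (α_ M.X Q.E Q.E).hom ≫ M.X ◁ Q.mul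
      = (α_ Q.E Q.E M.X).inv ≫ Q.mul ▷ M.X ≫ M.d) ∧
  ((λ_ M.X).inv ≫ Q.unit ▷ M.X ≫ M.d = (ρ_ M.X).inv ≫ M.X ◁ Q.unit) ∧
  (Q.comul ▷ M.X ≫ (α_ Q.E Q.E M.X).hom ≫ Q.E ◁ M.d ≫ (α_ Q.E M.X Q.E).inv ≫
      M.d ▷ Q.E ≫ (α_ M.X Q.E Q.E).hom = M.d ≫ M.X ◁ Q.comul) ∧
  (M.d ≫ M.X ◁ Q.counit ≫ (ρ_ M.X).hom = Q.counit ▷ M.X ≫ (λ_ M.X).hom) ∧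
  ((ρ_ M.X).inv ≫ M.X ◁ Q.Φ = (λ_ M.X).inv ≫ Q.Φ ▷ M.X ≫ dext M.d (dext M.d M.d)) ∧
  (Q.E ◁ M.d ≫ (α_ Q.E M.X Q.E).inv ≫ M.d ▷ Q.E ≫ (α_ M.X Q.E Q.E).hom ≫ M.X ◁ Q.τ
      = (α_ Q.E Q.E M.X).inv ≫ Q.τ ▷ M.X ≫ (α_ Q.E Q.E M.X).hom ≫ Q.E ◁ M.d ≫
        (α_ Q.E M.X Q.E).inv ≫ M.d ▷ Q.E ≫ (α_ M.X Q.E Q.E).hom) ∧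
  ((α_ Q.E Q.E M.X).inv ≫ Q.mul ▷ M.X ≫ M.act = Q.E ◁ M.act ≫ M.act) ∧
  ((λ_ M.X).inv ≫ Q.unit ▷ M.X ≫ M.act = 𝟙 M.X) ∧
  (Q.E ◁ M.act ≫ M.d
      = (α_ Q.E Q.E M.X).inv ≫ Q.τ ▷ M.X ≫ (α_ Q.E Q.E M.X).hom ≫ Q.E ◁ M.d ≫
        (α_ Q.E M.X Q.E).inv ≫ M.act ▷ Q.E)

/-- Morphisms of Tambara modules: left `F`-linear 2-cells compatible with the
distributive laws. -/
def IsQBHom (Q : QuasiBimonad a) (M N : QBModData Q) (f : M.X ⟶ N.X) : Prop :=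
  (M.act ≫ f = Q.E ◁ f ≫ N.act) ∧ (M.d ≫ f ▷ Q.E = Q.E ◁ f ≫ N.d)

/-- The tensor product of two Tambara modules: the composite 1-cell with the
composite distributive law and the diagonal action through `Δ`. -/
def qbTensor (Q : QuasiBimonad a) (M N : QBModData Q) : QBModData Q where
  X := M.X ≫ N.X
  d := dext' M.d N.d
  act := Q.comul ▷ (M.X ≫ N.X) ≫ actT M.d M.act N.act

/-- The unit object `(Id_A, id_F)` with the trivial `F`-action. -/
def qbUnit (Q : QuasiBimonad a) : QBModData Q where
  X := 𝟙 a
  d := (ρ_ Q.E).hom ≫ (λ_ Q.E).inv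
  act := (ρ_ Q.E).hom ≫ Q.counit

/-- The associativity constraint of the category of Tambara modules, given by the
action of `Φ`. -/
def qbAssoc (Q : QuasiBimonad a) (M N P : QBModData Q) :
    (M.X ≫ N.X) ≫ P.X ⟶ M.X ≫ N.X ≫ P.X :=
  (α_ M.X N.X P.X).hom ≫ (λ_ (M.X ≫ N.X ≫ P.X)).inv ≫ Q.Φ ▷ (M.X ≫ N.X ≫ P.X) ≫
    actT (dext M.d M.d) M.act (actT N.d N.act P.act)

section Coherence

variable {K : Type*} [Bicategory K] {a : K}

/-- The associativity law of an action `ρ` of `(T, m)` on `Z`. -/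
def ActAssoc {T Z : a ⟶ a} (m : T ≫ T ⟶ T) (ρ : T ≫ Z ⟶ Z) : Prop :=
  (α_ T T Z).inv ≫ m ▷ Z ≫ ρ = T ◁ ρ ≫ ρ

/-- The compatibility of a distributive law `d` with a multiplication `m`. -/
def MulCross {P X : a ⟶ a} (m : P ≫ P ⟶ P) (d : P ≫ X ⟶ X ≫ P) : Prop :=
  P ◁ d ≫ (α_ P X P).inv ≫ d ▷ P ≫ (α_ X P P).hom ≫ X ◁ m = (α_ P P X).inv ≫ m ▷ X ≫ d

/-- The Yang–Baxter equation for `t`, `dP`, `dQ`. -/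
def YangBaxter {P Q X : a ⟶ a} (t : P ≫ Q ⟶ Q ≫ P) (dP : P ≫ X ⟶ X ≫ P)
    (dQ : Q ≫ X ⟶ X ≫ Q) : Prop :=
  P ◁ dQ ≫ (α_ P X Q).inv ≫ dP ▷ Q ≫ (α_ X P Q).hom ≫ X ◁ t
    = (α_ P Q X).inv ≫ t ▷ X ≫ (α_ Q P X).hom ≫ Q ◁ dP ≫ (α_ Q X P).inv ≫
      dQ ▷ P ≫ (α_ X Q P).hom

/-- The compatibility of an action `ρ` of `Q` on `X` with the distributive laws of `P`
over `Q` and `X`. -/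
def ActCross {P Q X : a ⟶ a} (t : P ≫ Q ⟶ Q ≫ P) (d : P ≫ X ⟶ X ≫ P)
    (ρ : Q ≫ X ⟶ X) : Prop :=
  P ◁ ρ ≫ d = (α_ P Q X).inv ≫ t ▷ X ≫ (α_ Q P X).hom ≫ Q ◁ d ≫ (α_ Q X P).inv ≫ ρ ▷ P

/-- The endomorphism of `Z` given by the action of an element `f : 𝟙 a ⟶ T`. -/
def elemAct {T Z : a ⟶ a} (f : 𝟙 a ⟶ T) (ρ : T ≫ Z ⟶ Z) : Z ⟶ Z :=
  (λ_ Z).inv ≫ f ▷ Z ≫ ρ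

theorem elemAct_conv {T Z : a ⟶ a} {m : T ≫ T ⟶ T} {ρ : T ≫ Z ⟶ Z} (h : ActAssoc m ρ)
    (f g : 𝟙 a ⟶ T) : elemAct (conv m f g) ρ = elemAct g ρ ≫ elemAct f ρ := by
  unfold ActAssoc at h
  unfold elemAct conv
  calc
    _ = 𝟙 _ ⊗≫ f ▷ Z ⊗≫ T ◁ g ▷ Z ⊗≫ ((α_ T T Z).inv ≫ m ▷ Z ≫ ρ) := by bicategory
    _ = 𝟙 _ ⊗≫ (f ▷ (𝟙 a ≫ Z) ≫ T ◁ (g ▷ Z ≫ ρ)) ⊗≫ ρ := by rw [h]; bicategory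
    _ = 𝟙 _ ⊗≫ (𝟙 a ◁ (g ▷ Z ≫ ρ) ≫ f ▷ Z) ⊗≫ ρ := by rw [whisker_exchange]
    _ = _ := by bicategory

theorem actT_assoc {P Q X Y : a ⟶ a} {mQ : Q ≫ Q ⟶ Q} {mP : P ≫ P ⟶ P}
    {t : P ≫ Q ⟶ Q ≫ P} {d : P ≫ X ⟶ X ≫ P} {ρ : Q ≫ X ⟶ X} {σ : P ≫ Y ⟶ Y}
    (hρ : ActAssoc mQ ρ) (hσ : ActAssoc mP σ) (hd : MulCross mP d) (hc : ActCross t d ρ) :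
    ActAssoc (tmul mQ mP t) (actT d ρ σ) := by
  unfold ActAssoc at hρ hσ
  unfold MulCross at hd
  unfold ActCross at hc
  unfold ActAssoc tmul actT
  calc
    _ = 𝟙 _ ⊗≫ Q ◁ t ▷ P ▷ X ▷ Y ⊗≫ mQ ▷ P ▷ P ▷ X ▷ Y ⊗≫
          Q ◁ ((α_ P P X).inv ≫ mP ▷ X ≫ d) ▷ Y ⊗≫ ρ ▷ P ▷ Y ⊗≫ X ◁ σ := by bicategory
    _ = 𝟙 _ ⊗≫ Q ◁ t ▷ P ▷ X ▷ Y ⊗≫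
          (mQ ▷ (P ≫ P ≫ X) ≫
            Q ◁ (P ◁ d ≫ (α_ P X P).inv ≫ d ▷ P ≫ (α_ X P P).hom ≫ X ◁ mP)) ▷ Y ⊗≫
            ρ ▷ P ▷ Y ⊗≫ X ◁ σ := by rw [← hd]; bicategory
    _ = 𝟙 _ ⊗≫ Q ◁ (t ▷ (P ≫ X) ≫ (Q ≫ P) ◁ d) ▷ Y ⊗≫ Q ◁ Q ◁ d ▷ P ▷ Y ⊗≫
          Q ◁ Q ◁ X ◁ mP ▷ Y ⊗≫ ((α_ Q Q X).inv ≫ mQ ▷ X ≫ ρ) ▷ P ▷ Y ⊗≫ X ◁ σ := by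
        rw [← whisker_exchange]; bicategory
    _ = 𝟙 _ ⊗≫ Q ◁ P ◁ Q ◁ d ▷ Y ⊗≫ Q ◁ t ▷ X ▷ P ▷ Y ⊗≫ Q ◁ Q ◁ d ▷ P ▷ Y ⊗≫
          Q ◁ ((Q ≫ X) ◁ (mP ▷ Y) ≫ ρ ▷ (P ≫ Y)) ⊗≫ ρ ▷ P ▷ Y ⊗≫ X ◁ σ := by
        rw [hρ, ← whisker_exchange]; bicategory
    _ = 𝟙 _ ⊗≫ Q ◁ P ◁ Q ◁ d ▷ Y ⊗≫ Q ◁ t ▷ X ▷ P ▷ Y ⊗≫ Q ◁ Q ◁ d ▷ P ▷ Y ⊗≫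
          Q ◁ ρ ▷ P ▷ P ▷ Y ⊗≫ Q ◁ X ◁ mP ▷ Y ⊗≫ ρ ▷ P ▷ Y ⊗≫ X ◁ σ := by
        rw [whisker_exchange]; bicategory
    _ = 𝟙 _ ⊗≫ Q ◁ P ◁ Q ◁ d ▷ Y ⊗≫ Q ◁ t ▷ X ▷ P ▷ Y ⊗≫ Q ◁ Q ◁ d ▷ P ▷ Y ⊗≫
          Q ◁ ρ ▷ P ▷ P ▷ Y ⊗≫ ((Q ≫ X) ◁ (mP ▷ Y) ≫ ρ ▷ (P ≫ Y)) ⊗≫ X ◁ σ := by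
        bicategory
    _ = 𝟙 _ ⊗≫ Q ◁ P ◁ Q ◁ d ▷ Y ⊗≫
          Q ◁ ((α_ P Q X).inv ≫ t ▷ X ≫ (α_ Q P X).hom ≫ Q ◁ d ≫ (α_ Q X P).inv ≫ ρ ▷ P) ▷
            P ▷ Y ⊗≫ ρ ▷ P ▷ P ▷ Y ⊗≫ X ◁ ((α_ P P Y).inv ≫ mP ▷ Y ≫ σ) := by
        rw [whisker_exchange]; bicategory
    _ = 𝟙 _ ⊗≫ Q ◁ P ◁ Q ◁ d ▷ Y ⊗≫ Q ◁ P ◁ ρ ▷ P ▷ Y ⊗≫ Q ◁ d ▷ P ▷ Y ⊗≫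
          (ρ ▷ (P ≫ P ≫ Y) ≫ X ◁ (P ◁ σ)) ⊗≫ X ◁ σ := by
        rw [← hc, hσ]; bicategory
    _ = 𝟙 _ ⊗≫ Q ◁ P ◁ Q ◁ d ▷ Y ⊗≫ Q ◁ P ◁ ρ ▷ P ▷ Y ⊗≫
          Q ◁ (d ▷ (P ≫ Y) ≫ (X ≫ P) ◁ σ) ⊗≫ ρ ▷ (P ≫ Y) ⊗≫ X ◁ σ := by
        rw [← whisker_exchange]; bicategory
    _ = _ := by rw [← whisker_exchange]; bicategory

theorem dext_mulCross {P Q X : a ⟶ a} {mQ : Q ≫ Q ⟶ Q} {mP : P ≫ P ⟶ P}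
    {t : P ≫ Q ⟶ Q ≫ P} {dP : P ≫ X ⟶ X ≫ P} {dQ : Q ≫ X ⟶ X ≫ Q}
    (hP : MulCross mP dP) (hQ : MulCross mQ dQ) (hy : YangBaxter t dP dQ) :
    MulCross (tmul mQ mP t) (dext dQ dP) := by
  unfold MulCross at hP hQ
  unfold YangBaxter at hy
  unfold MulCross tmul dext
  calc
    _ = 𝟙 _ ⊗≫ Q ◁ P ◁ Q ◁ dP ⊗≫ Q ◁ P ◁ dQ ▷ P ⊗≫
          Q ◁ (dP ▷ (Q ≫ P) ≫ (X ≫ P) ◁ 𝟙 (Q ≫ P)) ⊗≫ dQ ▷ P ▷ Q ▷ P ⊗≫ X ◁ Q ◁ t ▷ P ⊗≫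
          X ◁ mQ ▷ P ▷ P ⊗≫ X ◁ Q ◁ mP := by bicategory
    _ = 𝟙 _ ⊗≫ Q ◁ P ◁ Q ◁ dP ⊗≫ Q ◁ P ◁ dQ ▷ P ⊗≫ Q ◁ dP ▷ Q ▷ P ⊗≫
          (dQ ▷ (P ≫ Q) ≫ (X ≫ Q) ◁ t) ▷ P ⊗≫
          X ◁ mQ ▷ P ▷ P ⊗≫ X ◁ Q ◁ mP := by bicategory
    _ = 𝟙 _ ⊗≫ Q ◁ P ◁ Q ◁ dP ⊗≫
          Q ◁ (P ◁ dQ ≫ (α_ P X Q).inv ≫ dP ▷ Q ≫ (α_ X P Q).hom ≫ X ◁ t) ▷ P ⊗≫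
          dQ ▷ Q ▷ P ▷ P ⊗≫
          X ◁ mQ ▷ P ▷ P ⊗≫ X ◁ Q ◁ mP := by rw [← whisker_exchange]; bicategory
    _ = 𝟙 _ ⊗≫ Q ◁ ((P ≫ Q) ◁ dP ≫ t ▷ (X ≫ P)) ⊗≫ Q ◁ Q ◁ dP ▷ P ⊗≫
          (Q ◁ dQ ≫ (α_ Q X Q).inv ≫ dQ ▷ Q ≫ (α_ X Q Q).hom ≫ X ◁ mQ) ▷ P ▷ P ⊗≫
          X ◁ Q ◁ mP := by rw [hy]; bicategory
    _ = 𝟙 _ ⊗≫ Q ◁ t ▷ P ▷ X ⊗≫ Q ◁ Q ◁ P ◁ dP ⊗≫ Q ◁ Q ◁ dP ▷ P ⊗≫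
          mQ ▷ X ▷ P ▷ P ⊗≫ (dQ ▷ (P ≫ P) ≫ (X ≫ Q) ◁ mP) ⊗≫ 𝟙 _ := by
        rw [hQ, whisker_exchange]; bicategory
    _ = 𝟙 _ ⊗≫ Q ◁ t ▷ P ▷ X ⊗≫ Q ◁ Q ◁ P ◁ dP ⊗≫ Q ◁ Q ◁ dP ▷ P ⊗≫
          (mQ ▷ (X ≫ P ≫ P) ≫ Q ◁ (X ◁ mP)) ⊗≫ dQ ▷ P ⊗≫ 𝟙 _ := by
        rw [← whisker_exchange]; bicategory
    _ = 𝟙 _ ⊗≫ Q ◁ t ▷ P ▷ X ⊗≫ Q ◁ Q ◁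
          (P ◁ dP ≫ (α_ P X P).inv ≫ dP ▷ P ≫ (α_ X P P).hom ≫ X ◁ mP) ⊗≫
          mQ ▷ X ▷ P ⊗≫ dQ ▷ P ⊗≫ 𝟙 _ := by
        rw [← whisker_exchange]; bicategory
    _ = 𝟙 _ ⊗≫ Q ◁ t ▷ P ▷ X ⊗≫ ((Q ≫ Q) ◁ (mP ▷ X ≫ dP) ≫ mQ ▷ (X ≫ P)) ⊗≫ dQ ▷ P ⊗≫ 𝟙 _ := by
        rw [hP]; bicategory
    _ = _ := by rw [whisker_exchange]; bicategory

theorem dext_actCross {P₁ P₂ Q X : a ⟶ a} {t₁ : P₁ ≫ Q ⟶ Q ≫ P₁} {t₂ : P₂ ≫ Q ⟶ Q ≫ P₂}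
    {d₁ : P₁ ≫ X ⟶ X ≫ P₁} {d₂ : P₂ ≫ X ⟶ X ≫ P₂} {ρ : Q ≫ X ⟶ X}
    (h₁ : ActCross t₁ d₁ ρ) (h₂ : ActCross t₂ d₂ ρ) :
    ActCross (dext t₁ t₂) (dext d₁ d₂) ρ := by
  unfold ActCross at h₁ h₂
  unfold ActCross dext
  calc
    _ = 𝟙 _ ⊗≫ P₁ ◁ (P₂ ◁ ρ ≫ d₂) ⊗≫ d₁ ▷ P₂ ⊗≫ 𝟙 _ := by bicategory
    _ = 𝟙 _ ⊗≫ P₁ ◁ t₂ ▷ X ⊗≫ P₁ ◁ Q ◁ d₂ ⊗≫ (P₁ ◁ ρ ≫ d₁) ▷ P₂ ⊗≫ 𝟙 _ := by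
        rw [h₂]; bicategory
    _ = 𝟙 _ ⊗≫ P₁ ◁ t₂ ▷ X ⊗≫ ((P₁ ≫ Q) ◁ d₂ ≫ t₁ ▷ (X ≫ P₂)) ⊗≫
          Q ◁ d₁ ▷ P₂ ⊗≫ ρ ▷ P₁ ▷ P₂ ⊗≫ 𝟙 _ := by
        rw [h₁]; bicategory
    _ = _ := by rw [whisker_exchange]; bicategory

theorem dext_yangBaxter {P₁ P₂ Q X : a ⟶ a} {t₁ : P₁ ≫ Q ⟶ Q ≫ P₁}
    {t₂ : P₂ ≫ Q ⟶ Q ≫ P₂} {d₁ : P₁ ≫ X ⟶ X ≫ P₁} {d₂ : P₂ ≫ X ⟶ X ≫ P₂}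
    {dQ : Q ≫ X ⟶ X ≫ Q} (h₁ : YangBaxter t₁ d₁ dQ) (h₂ : YangBaxter t₂ d₂ dQ) :
    YangBaxter (dext t₁ t₂) (dext d₁ d₂) dQ := by
  unfold YangBaxter at h₁ h₂
  unfold YangBaxter dext
  calc
    _ = 𝟙 _ ⊗≫ P₁ ◁ P₂ ◁ dQ ⊗≫ P₁ ◁ d₂ ▷ Q ⊗≫ (d₁ ▷ (P₂ ≫ Q) ≫ (X ≫ P₁) ◁ t₂) ⊗≫
          X ◁ t₁ ▷ P₂ ⊗≫ 𝟙 _ := by bicategory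
    _ = 𝟙 _ ⊗≫ P₁ ◁ (P₂ ◁ dQ ≫ (α_ P₂ X Q).inv ≫ d₂ ▷ Q ≫ (α_ X P₂ Q).hom ≫ X ◁ t₂) ⊗≫
          d₁ ▷ Q ▷ P₂ ⊗≫ X ◁ t₁ ▷ P₂ ⊗≫ 𝟙 _ := by rw [← whisker_exchange]; bicategory
    _ = 𝟙 _ ⊗≫ P₁ ◁ t₂ ▷ X ⊗≫ P₁ ◁ Q ◁ d₂ ⊗≫
          (P₁ ◁ dQ ≫ (α_ P₁ X Q).inv ≫ d₁ ▷ Q ≫ (α_ X P₁ Q).hom ≫ X ◁ t₁) ▷ P₂ ⊗≫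
          𝟙 _ := by rw [h₂]; bicategory
    _ = 𝟙 _ ⊗≫ P₁ ◁ t₂ ▷ X ⊗≫ ((P₁ ≫ Q) ◁ d₂ ≫ t₁ ▷ (X ≫ P₂)) ⊗≫
          Q ◁ d₁ ▷ P₂ ⊗≫ dQ ▷ P₁ ▷ P₂ ⊗≫ 𝟙 _ := by rw [h₁]; bicategory
    _ = _ := by rw [whisker_exchange]; bicategory

/-- A 2-cell `h : P ⟶ P'` is compatible with distributive laws over `X`. -/
def NatCross {P P' X : a ⟶ a} (h : P ⟶ P') (d : P ≫ X ⟶ X ≫ P) (d' : P' ≫ X ⟶ X ≫ P') :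
    Prop :=
  h ▷ X ≫ d' = d ≫ X ◁ h

theorem actT_natural_right {P P' Q X Y : a ⟶ a} {h : P ⟶ P'} {d : P ≫ X ⟶ X ≫ P}
    {d' : P' ≫ X ⟶ X ≫ P'} (hh : NatCross h d d') (ρ : Q ≫ X ⟶ X) (σ : P' ≫ Y ⟶ Y) :
    (Q ◁ h) ▷ (X ≫ Y) ≫ actT d' ρ σ = actT d ρ (h ▷ Y ≫ σ) := by
  unfold NatCross at hh
  unfold actT
  calc
    _ = 𝟙 _ ⊗≫ Q ◁ (h ▷ X ≫ d') ▷ Y ⊗≫ ρ ▷ P' ▷ Y ⊗≫ X ◁ σ := by bicategory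
    _ = 𝟙 _ ⊗≫ Q ◁ d ▷ Y ⊗≫ ((Q ≫ X) ◁ h ≫ ρ ▷ P') ▷ Y ⊗≫ X ◁ σ := by rw [hh]; bicategory
    _ = _ := by rw [whisker_exchange]; bicategory

theorem actT_natural_left {P Q Q' X Y : a ⟶ a} (h : Q ⟶ Q') (d : P ≫ X ⟶ X ≫ P)
    (ρ : Q' ≫ X ⟶ X) (σ : P ≫ Y ⟶ Y) :
    (h ▷ P) ▷ (X ≫ Y) ≫ actT d ρ σ = actT d (h ▷ X ≫ ρ) σ := by
  unfold actT
  calc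
    _ = 𝟙 _ ⊗≫ (h ▷ (P ≫ X) ≫ Q' ◁ d) ▷ Y ⊗≫ ρ ▷ P ▷ Y ⊗≫ X ◁ σ := by bicategory
    _ = _ := by rw [← whisker_exchange]; bicategory

theorem actT_conj {P Q X Y Y' : a ⟶ a} (i : Y' ≅ Y) (d : P ≫ X ⟶ X ≫ P) (ρ : Q ≫ X ⟶ X)
    (σ : P ≫ Y' ⟶ Y') :
    actT d ρ (P ◁ i.inv ≫ σ ≫ i.hom)
      = (Q ≫ P) ◁ X ◁ i.inv ≫ actT d ρ σ ≫ X ◁ i.hom := by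
  unfold actT
  calc
    _ = 𝟙 _ ⊗≫ Q ◁ d ▷ Y ⊗≫ (ρ ▷ (P ≫ Y) ≫ X ◁ (P ◁ i.inv)) ⊗≫ X ◁ (σ ≫ i.hom) := by
        bicategory
    _ = 𝟙 _ ⊗≫ Q ◁ (d ▷ Y ≫ (X ≫ P) ◁ i.inv) ⊗≫ ρ ▷ (P ≫ Y') ⊗≫ X ◁ (σ ≫ i.hom) := by
        rw [← whisker_exchange]; bicategory
    _ = _ := by rw [← whisker_exchange]; bicategory

theorem actT_reassoc {Q₁ Q₂ P X Y Z : a ⟶ a} (dQ : Q₂ ≫ X ⟶ X ≫ Q₂) (dP : P ≫ X ⟶ X ≫ P)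
    (eP : P ≫ Y ⟶ Y ≫ P) (ρ : Q₁ ≫ X ⟶ X) (σ : Q₂ ≫ Y ⟶ Y) (υ : P ≫ Z ⟶ Z) :
    (α_ Q₁ Q₂ P).hom ▷ (X ≫ Y ≫ Z) ≫ actT (dext dQ dP) ρ (actT eP σ υ)
      = ((Q₁ ≫ Q₂) ≫ P) ◁ (α_ X Y Z).inv ≫
          actT (dext' dP eP) (actT dQ ρ σ) υ ≫ (α_ X Y Z).hom := by
  unfold actT dext dext'
  calc
    _ = 𝟙 _ ⊗≫ Q₁ ◁ Q₂ ◁ dP ▷ Y ▷ Z ⊗≫ Q₁ ◁ dQ ▷ P ▷ Y ▷ Z ⊗≫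
          (ρ ▷ (Q₂ ≫ P ≫ Y) ≫ X ◁ (Q₂ ◁ eP)) ▷ Z ⊗≫ X ◁ σ ▷ P ▷ Z ⊗≫ X ◁ Y ◁ υ ⊗≫ 𝟙 _ := by
        bicategory
    _ = 𝟙 _ ⊗≫ Q₁ ◁ Q₂ ◁ dP ▷ Y ▷ Z ⊗≫ Q₁ ◁ (dQ ▷ (P ≫ Y) ≫ (X ≫ Q₂) ◁ eP) ▷ Z ⊗≫
          ρ ▷ Q₂ ▷ Y ▷ P ▷ Z ⊗≫ X ◁ σ ▷ P ▷ Z ⊗≫ X ◁ Y ◁ υ ⊗≫ 𝟙 _ := by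
        rw [← whisker_exchange]; bicategory
    _ = _ := by rw [← whisker_exchange]; bicategory

theorem dext_dext' {P₁ P₂ X Y : a ⟶ a} (d₁ : P₁ ≫ X ⟶ X ≫ P₁) (d₂ : P₂ ≫ X ⟶ X ≫ P₂)
    (e₁ : P₁ ≫ Y ⟶ Y ≫ P₁) (e₂ : P₂ ≫ Y ⟶ Y ≫ P₂) :
    dext (dext' d₁ e₁) (dext' d₂ e₂) = dext' (dext d₁ d₂) (dext e₁ e₂) := by
  unfold dext dext'
  calc
    _ = 𝟙 _ ⊗≫ P₁ ◁ d₂ ▷ Y ⊗≫ ((P₁ ≫ X) ◁ e₂ ≫ d₁ ▷ (Y ≫ P₂)) ⊗≫ X ◁ e₁ ▷ P₂ ⊗≫ 𝟙 _ := by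
        bicategory
    _ = _ := by rw [whisker_exchange]; bicategory

theorem dext_natural_right {P₁ P₂ P₂' X : a ⟶ a} {h : P₂ ⟶ P₂'} {d : P₂ ≫ X ⟶ X ≫ P₂}
    {d' : P₂' ≫ X ⟶ X ≫ P₂'} (hh : NatCross h d d') (e : P₁ ≫ X ⟶ X ≫ P₁) :
    NatCross (P₁ ◁ h) (dext e d) (dext e d') := by
  unfold NatCross at hh
  unfold NatCross dext
  calc
    _ = 𝟙 _ ⊗≫ P₁ ◁ (h ▷ X ≫ d') ⊗≫ e ▷ P₂' ⊗≫ 𝟙 _ := by bicategory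
    _ = 𝟙 _ ⊗≫ P₁ ◁ d ⊗≫ ((P₁ ≫ X) ◁ h ≫ e ▷ P₂') ⊗≫ 𝟙 _ := by rw [hh]; bicategory
    _ = _ := by rw [whisker_exchange]; bicategory

theorem dext_natural_left {P₁ P₁' P₂ X : a ⟶ a} {h : P₁ ⟶ P₁'} {d : P₁ ≫ X ⟶ X ≫ P₁}
    {d' : P₁' ≫ X ⟶ X ≫ P₁'} (hh : NatCross h d d') (e : P₂ ≫ X ⟶ X ≫ P₂) :
    NatCross (h ▷ P₂) (dext d e) (dext d' e) := by
  unfold NatCross at hh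
  unfold NatCross dext
  calc
    _ = 𝟙 _ ⊗≫ (h ▷ (P₂ ≫ X) ≫ P₁' ◁ e) ⊗≫ d' ▷ P₂ ⊗≫ 𝟙 _ := by bicategory
    _ = 𝟙 _ ⊗≫ P₁ ◁ e ⊗≫ (h ▷ X ≫ d') ▷ P₂ ⊗≫ 𝟙 _ := by
        rw [← whisker_exchange]; bicategory
    _ = _ := by rw [hh]; bicategory

theorem dext_natural_assoc {P₁ P₂ P₃ X : a ⟶ a} (d₁ : P₁ ≫ X ⟶ X ≫ P₁)
    (d₂ : P₂ ≫ X ⟶ X ≫ P₂) (d₃ : P₃ ≫ X ⟶ X ≫ P₃) :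
    NatCross (α_ P₁ P₂ P₃).hom (dext (dext d₁ d₂) d₃) (dext d₁ (dext d₂ d₃)) := by
  unfold NatCross dext
  bicategory

theorem NatCross.comp {P P' P'' X : a ⟶ a} {h : P ⟶ P'} {h' : P' ⟶ P''}
    {d : P ≫ X ⟶ X ≫ P} {d' : P' ≫ X ⟶ X ≫ P'} {d'' : P'' ≫ X ⟶ X ≫ P''}
    (hh : NatCross h d d') (hh' : NatCross h' d' d'') : NatCross (h ≫ h') d d'' := by
  unfold NatCross at *
  rw [comp_whiskerRight, Category.assoc, hh', reassoc_of% hh, whiskerLeft_comp]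

/-- An element `u : 𝟙 a ⟶ P` crosses `X` freely. -/
def ElemCross {P X : a ⟶ a} (u : 𝟙 a ⟶ P) (d : P ≫ X ⟶ X ≫ P) : Prop :=
  (λ_ X).inv ≫ u ▷ X ≫ d = (ρ_ X).inv ≫ X ◁ u

theorem dext'_elemCross {P X Y : a ⟶ a} {u : 𝟙 a ⟶ P} {d : P ≫ X ⟶ X ≫ P}
    {e : P ≫ Y ⟶ Y ≫ P} (hd : ElemCross u d) (he : ElemCross u e) :
    ElemCross u (dext' d e) := by
  unfold ElemCross at hd he
  unfold ElemCross dext'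
  calc
    _ = 𝟙 _ ⊗≫ ((λ_ X).inv ≫ u ▷ X ≫ d) ▷ Y ⊗≫ X ◁ e ⊗≫ 𝟙 _ := by bicategory
    _ = 𝟙 _ ⊗≫ X ◁ ((λ_ Y).inv ≫ u ▷ Y ≫ e) ⊗≫ 𝟙 _ := by rw [hd]; bicategory
    _ = _ := by rw [he]; bicategory

theorem elemAct_tunit_left {P Q X Y : a ⟶ a} {u : 𝟙 a ⟶ Q} {φ : 𝟙 a ⟶ P}
    {d : P ≫ X ⟶ X ≫ P} {ρ : Q ≫ X ⟶ X} (σ : P ≫ Y ⟶ Y) (hu : elemAct u ρ = 𝟙 X)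
    (hφ : ElemCross φ d) :
    elemAct (tunit u φ) (actT d ρ σ) = X ◁ elemAct φ σ := by
  unfold ElemCross at hφ
  unfold elemAct at hu
  unfold elemAct actT tunit
  calc
    _ = 𝟙 _ ⊗≫ u ▷ X ▷ Y ⊗≫ Q ◁ ((λ_ X).inv ≫ φ ▷ X ≫ d) ▷ Y ⊗≫ ρ ▷ P ▷ Y ⊗≫ X ◁ σ := by
        bicategory
    _ = 𝟙 _ ⊗≫ u ▷ X ▷ Y ⊗≫ ((Q ≫ X) ◁ φ ≫ ρ ▷ P) ▷ Y ⊗≫ X ◁ σ := by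
        rw [hφ]; bicategory
    _ = 𝟙 _ ⊗≫ ((λ_ X).inv ≫ u ▷ X ≫ ρ) ▷ Y ⊗≫ X ◁ φ ▷ Y ⊗≫ X ◁ σ := by
        rw [whisker_exchange]; bicategory
    _ = _ := by rw [hu]; bicategory

theorem elemAct_tunit_right {P Q X Y : a ⟶ a} {u : 𝟙 a ⟶ P} {φ : 𝟙 a ⟶ Q}
    {d : P ≫ X ⟶ X ≫ P} (ρ : Q ≫ X ⟶ X) {σ : P ≫ Y ⟶ Y} (hu : elemAct u σ = 𝟙 Y)
    (hd : ElemCross u d) :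
    elemAct (tunit φ u) (actT d ρ σ) = elemAct φ ρ ▷ Y := by
  unfold ElemCross at hd
  unfold elemAct at hu
  unfold elemAct actT tunit
  calc
    _ = 𝟙 _ ⊗≫ φ ▷ X ▷ Y ⊗≫ Q ◁ ((λ_ X).inv ≫ u ▷ X ≫ d) ▷ Y ⊗≫ ρ ▷ P ▷ Y ⊗≫ X ◁ σ := by
        bicategory
    _ = 𝟙 _ ⊗≫ φ ▷ X ▷ Y ⊗≫ ((Q ≫ X) ◁ u ≫ ρ ▷ P) ▷ Y ⊗≫ X ◁ σ := by
        rw [hd]; bicategory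
    _ = 𝟙 _ ⊗≫ φ ▷ X ▷ Y ⊗≫ ρ ▷ Y ⊗≫ X ◁ ((λ_ Y).inv ≫ u ▷ Y ≫ σ) := by
        rw [whisker_exchange]; bicategory
    _ = _ := by rw [hu]; bicategory

theorem elemAct_comp {T T' Z : a ⟶ a} (f : 𝟙 a ⟶ T) (h : T ⟶ T') (ρ : T' ≫ Z ⟶ Z) :
    elemAct (f ≫ h) ρ = elemAct f (h ▷ Z ≫ ρ) := by
  simp [elemAct]

theorem elemAct_conj {T Z Z' : a ⟶ a} (f : 𝟙 a ⟶ T) (i : Z ≅ Z') (ρ : T ≫ Z ⟶ Z) :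
    elemAct f (T ◁ i.inv ≫ ρ ≫ i.hom) = i.inv ≫ elemAct f ρ ≫ i.hom := by
  unfold elemAct
  rw [← whisker_exchange_assoc]
  simp

end Coherence

section Tambara

variable {K : Type*} [Bicategory K] {a : K} {Q : QuasiBimonad a}

theorem IsQBMod.mulCross {M : QBModData Q} (h : IsQBMod Q M) : MulCross Q.mul M.d := h.1

theorem IsQBMod.unitCross {M : QBModData Q} (h : IsQBMod Q M) : ElemCross Q.unit M.d := h.2.1

theorem IsQBMod.comulCross {M : QBModData Q} (h : IsQBMod Q M) :
    NatCross Q.comul M.d (dext M.d M.d) := h.2.2.1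

theorem IsQBMod.reassociatorCross {M : QBModData Q} (h : IsQBMod Q M) :
    ElemCross Q.Φ (dext M.d (dext M.d M.d)) := h.2.2.2.2.1.symm

theorem IsQBMod.yangBaxter {M : QBModData Q} (h : IsQBMod Q M) :
    YangBaxter Q.τ M.d M.d := h.2.2.2.2.2.1

theorem IsQBMod.actAssoc {M : QBModData Q} (h : IsQBMod Q M) : ActAssoc Q.mul M.act :=
  h.2.2.2.2.2.2.1

theorem IsQBMod.unitAct {M : QBModData Q} (h : IsQBMod Q M) : elemAct Q.unit M.act = 𝟙 M.X :=
  h.2.2.2.2.2.2.2.1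

theorem IsQBMod.actCross {M : QBModData Q} (h : IsQBMod Q M) : ActCross Q.τ M.d M.act :=
  h.2.2.2.2.2.2.2.2

/-- The componentwise action of `E ≫ E ≫ E` on a triple product. -/
def act3 (M N P : QBModData Q) :
    (Q.E ≫ Q.E ≫ Q.E) ≫ M.X ≫ N.X ≫ P.X ⟶ M.X ≫ N.X ≫ P.X :=
  actT (dext M.d M.d) M.act (actT N.d N.act P.act)

/-- The componentwise action of `E ≫ E ≫ E ≫ E` on a fourfold product. -/
def act4 (M N P R : QBModData Q) :
    (Q.E ≫ Q.E ≫ Q.E ≫ Q.E) ≫ M.X ≫ N.X ≫ P.X ≫ R.X ⟶ M.X ≫ N.X ≫ P.X ≫ R.X :=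
  actT (dext M.d (dext M.d M.d)) M.act (act3 N P R)

theorem qbAssoc_eq (M N P : QBModData Q) :
    qbAssoc Q M N P = (α_ M.X N.X P.X).hom ≫ elemAct Q.Φ (act3 M N P) := rfl

theorem act4_assoc {M N P R : QBModData Q} (hM : IsQBMod Q M) (hN : IsQBMod Q N)
    (hP : IsQBMod Q P) (hR : IsQBMod Q R) :
    ActAssoc (mul4 Q.mul Q.τ) (act4 M N P R) := by
  have h2 : ActAssoc (tmul Q.mul Q.mul Q.τ) (actT P.d P.act R.act) :=
    actT_assoc hP.actAssoc hR.actAssoc hP.mulCross hP.actCross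
  have h3 : ActAssoc (mul3 Q.mul Q.τ) (act3 N P R) :=
    actT_assoc hN.actAssoc h2 (dext_mulCross hN.mulCross hN.mulCross hN.yangBaxter)
      (dext_actCross hN.actCross hN.actCross)
  exact actT_assoc hM.actAssoc h3
    (dext_mulCross (dext_mulCross hM.mulCross hM.mulCross hM.yangBaxter) hM.mulCross
      (dext_yangBaxter hM.yangBaxter hM.yangBaxter))
    (dext_actCross hM.actCross (dext_actCross hM.actCross hM.actCross))

theorem elemAct_act4_unit_left {M : QBModData Q} (hM : IsQBMod Q M) (N P R : QBModData Q) :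
    elemAct (tunit Q.unit Q.Φ) (act4 M N P R) = M.X ◁ elemAct Q.Φ (act3 N P R) :=
  elemAct_tunit_left _ hM.unitAct hM.reassociatorCross

theorem elemAct_act4_unit_right {M N P R : QBModData Q} (hM : IsQBMod Q M)
    (hN : IsQBMod Q N) (hP : IsQBMod Q P) (hR : IsQBMod Q R) :
    elemAct (tunit Q.Φ Q.unit ≫ (α_ Q.E (Q.E ≫ Q.E) Q.E).hom ≫ Q.E ◁ (α_ Q.E Q.E Q.E).hom)
        (act4 M N P R)
      = M.X ◁ (α_ N.X P.X R.X).inv ≫ (α_ M.X (N.X ≫ P.X) R.X).inv ≫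
          elemAct Q.Φ (act3 M N P) ▷ R.X ≫ (α_ M.X (N.X ≫ P.X) R.X).hom ≫
            M.X ◁ (α_ N.X P.X R.X).hom := by
  have key : ((α_ Q.E (Q.E ≫ Q.E) Q.E).hom ≫ Q.E ◁ (α_ Q.E Q.E Q.E).hom) ▷
        (M.X ≫ N.X ≫ P.X ≫ R.X) ≫ act4 M N P R
      = _ ◁ (whiskerLeftIso M.X (α_ N.X P.X R.X)).inv ≫
          (_ ◁ (α_ M.X (N.X ≫ P.X) R.X).inv ≫
            actT (dext' M.d (dext' N.d P.d)) (act3 M N P) R.act ≫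
              (α_ M.X (N.X ≫ P.X) R.X).hom) ≫
            (whiskerLeftIso M.X (α_ N.X P.X R.X)).hom := by
    unfold act4 act3
    rw [comp_whiskerRight, Category.assoc,
      actT_natural_right (dext_natural_assoc M.d M.d M.d), actT_reassoc, actT_conj,
      ← whisker_exchange_assoc, reassoc_of% actT_reassoc]
    simp
  rw [elemAct_comp, key, elemAct_conj, elemAct_conj,
    elemAct_tunit_right _ hR.unitAct
      (dext'_elemCross hM.unitCross (dext'_elemCross hN.unitCross hP.unitCross))]
  simp

theorem elemAct_act4_comul_left (M N P R : QBModData Q) :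
    elemAct (Q.Φ ≫ Q.comul ▷ (Q.E ≫ Q.E) ≫ (α_ Q.E Q.E (Q.E ≫ Q.E)).hom) (act4 M N P R)
      = (α_ M.X N.X (P.X ≫ R.X)).inv ≫ elemAct Q.Φ (act3 (qbTensor Q M N) P R) ≫
          (α_ M.X N.X (P.X ≫ R.X)).hom := by
  unfold act4 act3
  rw [elemAct_comp, comp_whiskerRight, Category.assoc, actT_reassoc,
    ← whisker_exchange_assoc, reassoc_of% actT_natural_left, elemAct_conj]
  simp only [qbTensor, dext_dext']

theorem elemAct_act4_comul_right {M N : QBModData Q} (hM : IsQBMod Q M) (hN : IsQBMod Q N)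
    (P R : QBModData Q) :
    elemAct (Q.Φ ≫ Q.E ◁ (Q.E ◁ Q.comul)) (act4 M N P R)
      = elemAct Q.Φ (act3 M N (qbTensor Q P R)) := by
  unfold act4 act3
  rw [elemAct_comp, actT_natural_right (dext_natural_right hM.comulCross _),
    actT_natural_right hN.comulCross]
  rfl

theorem elemAct_act4_comul_middle {M : QBModData Q} (hM : IsQBMod Q M)
    (N P R : QBModData Q) :
    elemAct (Q.Φ ≫ Q.E ◁ (Q.comul ▷ Q.E) ≫ Q.E ◁ (α_ Q.E Q.E Q.E).hom) (act4 M N P R)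
      = M.X ◁ (α_ N.X P.X R.X).inv ≫ elemAct Q.Φ (act3 M (qbTensor Q N P) R) ≫
          M.X ◁ (α_ N.X P.X R.X).hom := by
  unfold act4 act3
  rw [elemAct_comp, ← whiskerLeft_comp,
    actT_natural_right ((dext_natural_left hM.comulCross _).comp (dext_natural_assoc _ _ _)),
    comp_whiskerRight, Category.assoc, actT_reassoc,
    ← whisker_exchange_assoc, reassoc_of% actT_natural_left, actT_conj]
  exact elemAct_conj _ (whiskerLeftIso M.X (α_ N.X P.X R.X)) _

end Tambara

/-- For a quasi-bimonad `(A, F, Φ)` in `K` and left Tambara modules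
`X, Y, Z, W`, the associativity constraint `α` given by the action of `Φ` satisfies
the pentagon identity
`(Id_X × α_{Y,Z,W}) ∘ α_{X,YZ,W} ∘ (α_{X,Y,Z} × Id_W) = α_{X,Y,ZW} ∘ α_{XY,Z,W}`,
as a consequence of the 3-cocycle condition on `Φ`. -/
theorem pentagon_for_quasi_bimonad_assoc {K : Type*} [Bicategory K]
    [Bicategory.Strict K] {a : K} (Q : QuasiBimonad a)
    (M N P R : QBModData Q) (hM : IsQBMod Q M) (hN : IsQBMod Q N)
    (hP : IsQBMod Q P) (hR : IsQBMod Q R) :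
    qbAssoc Q M N P ▷ R.X ≫ qbAssoc Q M (qbTensor Q N P) R ≫ M.X ◁ qbAssoc Q N P R
      = qbAssoc Q (qbTensor Q M N) P R ≫ qbAssoc Q M N (qbTensor Q P R) := by
  have h := congrArg (fun f => elemAct f (act4 M N P R)) Q.cocycle
  simp only [elemAct_conv (act4_assoc hM hN hP hR), elemAct_act4_unit_left hM,
    elemAct_act4_unit_right hM hN hP hR, elemAct_act4_comul_left,
    elemAct_act4_comul_right hM hN, elemAct_act4_comul_middle hM] at h
  have h' := (((α_ (M.X ≫ N.X) P.X R.X).hom ≫ (α_ M.X N.X (P.X ≫ R.X)).hom) ≫= h)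
  simp only [qbAssoc_eq]
  dsimp only [qbTensor] at h' ⊢
  refine Eq.trans ?_ (h'.trans ?_)
  · simp only [comp_whiskerRight, whiskerLeft_comp, Category.assoc]
    bicategory
  · simp

end Paper
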